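/- For every integer k ≥ r + 1, the subspaces Im((1 − C_q)^{(a,a+1)}), a = 1, …, k − 1, span all of V^{⊗k}; equivalently, the k-th graded component of the quadratic algebra Ξ_{C_q}(K) is zero for k ≥ r + 1. -/

import Mathlib

open scoped BigOperators

noncomputable section

/-- The index set `I = {-r, …, -1, 1, …, r}` as a subtype of `ℤ`. -/
abbrev SIdx (r : ℕ) : Type := {i : ℤ // i ∈ (Finset.Icc (-(r : ℤ)) (r : ℤ)).erase 0}

instance (r : ℕ) : Neg (SIdx r) :=
  ⟨fun i => ⟨-i.1, by
    obtain ⟨h1, h2⟩ := Finset.mem_erase.mp i.2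
    rw [Finset.mem_Icc] at h2
    exact Finset.mem_erase.mpr ⟨neg_ne_zero.mpr h1, Finset.mem_Icc.mpr (by omega)⟩⟩⟩

/-- The sign `ε_i`: `1` for `i > 0` and `-1` for `i < 0`, as an element of `K`. -/
def sgn (K : Type*) [Field K] {r : ℕ} (i : SIdx r) : K := if 0 < i.1 then 1 else -1

/-- A symplectic parameter family `q = (q_{ij}, q_i)`: nonzero scalars with
`q_{ij} = q_{ji}⁻¹`, `q_{ii} = 1`, `q_{-i} = q_i⁻¹` and `q_{-i,j} = q_{ij}⁻¹ q_j²`. -/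
structure SympParam (K : Type*) [Field K] (r : ℕ) where
  qm : SIdx r → SIdx r → K
  qv : SIdx r → K
  qm_ne : ∀ i j, qm i j ≠ 0
  qv_ne : ∀ i, qv i ≠ 0
  qm_symm : ∀ i j, qm i j = (qm j i)⁻¹
  qm_diag : ∀ i, qm i i = 1
  qv_neg : ∀ i, qv (-i) = (qv i)⁻¹
  qm_neg : ∀ i j, qm (-i) j = (qm i j)⁻¹ * (qv j) ^ 2

variable {K : Type*} [Field K] [CharZero K] {r : ℕ}

/-- The operator `P_q` on `V ⊗ V`, where `V = SIdx r → K` and `V ⊗ V` is realized as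
`(SIdx r × SIdx r) → K` with basis vector `e l ⊗ e m = Pi.single (l, m) 1`.  It sends
`e l ⊗ e m ↦ q_{lm} • (e m ⊗ e l)`. -/
def Pq (q : SympParam K r) : Module.End K (SIdx r × SIdx r → K) where
  toFun f := fun p => q.qm p.2 p.1 * f (p.2, p.1)
  map_add' f g := by funext p; simp [mul_add]
  map_smul' c f := by funext p; simp [smul_eq_mul]; ring

/-- The operator `Q_q` on `V ⊗ V`: it sends
`e l ⊗ e m ↦ δ_{m,-l} ε_l q_l⁻¹ • ∑ i, ε_i q_i • (e i ⊗ e (-i))`. -/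
def Qq (q : SympParam K r) : Module.End K (SIdx r × SIdx r → K) where
  toFun f := fun p =>
    if p.2 = -p.1 then
      sgn K p.1 * q.qv p.1 * ∑ l : SIdx r, sgn K l * (q.qv l)⁻¹ * f (l, -l)
    else 0
  map_add' f g := by
    funext p
    by_cases h : p.2 = -p.1 <;> simp [h, mul_add, Finset.sum_add_distrib]
  map_smul' c f := by
    funext p
    by_cases h : p.2 = -p.1 <;>
      simp only [h, if_true, if_false, Pi.smul_apply, smul_eq_mul, RingHom.id_apply,
        Finset.mul_sum, mul_zero]
    · exact Finset.sum_congr rfl fun l _ => by ring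

/-- The operator `T^{(a,b)}` on `V^{⊗k} = (Fin k → SIdx r) → K` (for `a ≠ b`): it acts as
`T` on the `a`-th and `b`-th tensor factors and as the identity on all other factors. -/
def liftAB {k : ℕ} (T : Module.End K (SIdx r × SIdx r → K)) (a b : Fin k) :
    Module.End K ((Fin k → SIdx r) → K) where
  toFun f := fun v => ∑ l : SIdx r, ∑ m : SIdx r,
    T (Pi.single (l, m) 1) (v a, v b) * f (Function.update (Function.update v a l) b m)
  map_add' f g := by
    funext v
    simp [mul_add, Finset.sum_add_distrib]
  map_smul' c f := by
    funext v
    simp only [Pi.smul_apply, smul_eq_mul, RingHom.id_apply, Finset.mul_sum]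
    congr 1; funext l; congr 1; funext m; ring

/-- The idempotent `C_q = (1 − P_q)/2 − Q_q/(2r)` on `V ⊗ V`. -/
def Cq (q : SympParam K r) : Module.End K (SIdx r × SIdx r → K) :=
  (2 : K)⁻¹ • (1 - Pq q) - (2 * (r : K))⁻¹ • Qq q

set_option linter.unusedSectionVars false

section SquareZero

variable {B ι : Type*} [CommRing B]

theorem add_pow_succ_of_mul_self_eq_zero {a : B} (ha : a * a = 0) (b : B) (n : ℕ) :
    (a + b) ^ (n + 1) = b ^ (n + 1) + (n + 1 : ℕ) * (a * b ^ n) := by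
  induction n with
  | zero => simp [add_comm]
  | succ n ih =>
    rw [pow_succ, ih]
    push_cast
    linear_combination (n + 1 : B) * b ^ n * ha

theorem sum_pow_eq_zero_of_mul_self_eq_zero {w : ι → B} (hw : ∀ i, w i * w i = 0)
    (S : Finset ι) {n : ℕ} (hn : S.card < n) : (∑ i ∈ S, w i) ^ n = 0 := by
  classical
  induction S using Finset.induction_on generalizing n with
  | empty => exact (congrArg (· ^ n) Finset.sum_empty).trans (zero_pow (by simp at hn; omega))
  | insert a S ha ih =>
    rw [Finset.card_insert_of_notMem ha] at hn
    obtain ⟨m, rfl⟩ : ∃ m, n = m + 1 := ⟨n - 1, by omega⟩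
    rw [Finset.sum_insert ha, add_pow_succ_of_mul_self_eq_zero (hw a), ih (by omega),
      ih (by omega)]
    simp

theorem sum_pow_card_of_mul_self_eq_zero {w : ι → B} (hw : ∀ i, w i * w i = 0)
    (S : Finset ι) : (∑ i ∈ S, w i) ^ S.card = (S.card.factorial : B) * ∏ i ∈ S, w i := by
  classical
  induction S using Finset.induction_on with
  | empty => simp
  | insert a S ha ih =>
    rw [Finset.sum_insert ha, Finset.prod_insert ha, Finset.card_insert_of_notMem ha,
      add_pow_succ_of_mul_self_eq_zero (hw a), ih,
      sum_pow_eq_zero_of_mul_self_eq_zero hw S (Nat.lt_succ_self _), Nat.factorial_succ]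
    push_cast
    ring

end SquareZero

namespace SIdx

@[simp] theorem coe_neg (i : SIdx r) : ((-i : SIdx r) : ℤ) = -(i : ℤ) := rfl

@[simp] theorem neg_neg (i : SIdx r) : - -i = i := Subtype.ext (by simp)

theorem coe_ne_zero (i : SIdx r) : (i : ℤ) ≠ 0 := (Finset.mem_erase.mp i.2).1

/-- The positive indices `1, …, r`. -/
def pos (r : ℕ) : Finset (SIdx r) := Finset.univ.filter fun i => 0 < (i : ℤ)

theorem mem_pos {i : SIdx r} : i ∈ pos r ↔ 0 < (i : ℤ) := by simp [pos]

theorem card_pos : (pos r).card = r := by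
  have h : (pos r).map ⟨Subtype.val, Subtype.val_injective⟩ = Finset.Icc (1 : ℤ) r := by
    ext i
    simp only [Finset.mem_map, mem_pos, Function.Embedding.coeFn_mk, Finset.mem_Icc]
    constructor
    · rintro ⟨j, hj, rfl⟩
      have := Finset.mem_Icc.mp (Finset.mem_erase.mp j.2).2
      omega
    · intro hi
      exact ⟨⟨i, Finset.mem_erase.mpr ⟨by omega, Finset.mem_Icc.mpr (by omega)⟩⟩,
        by simpa using by omega, rfl⟩
  have := congrArg Finset.card h
  simpa using this

theorem sum_eq_sum_pos {M : Type*} [AddCommMonoid M] (f : SIdx r → M) :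
    ∑ i, f i = ∑ i ∈ pos r, (f i + f (-i)) := by
  rw [Finset.sum_add_distrib, ← Finset.sum_filter_add_sum_filter_not Finset.univ
    (fun i : SIdx r => 0 < (i : ℤ)) f]
  congr 1
  refine Finset.sum_nbij' (fun i => -i) (fun i => -i) ?_ ?_ ?_ ?_ ?_
  · intro i hi
    have := coe_ne_zero i
    simp [mem_pos] at hi ⊢
    omega
  · intro i hi
    simp [mem_pos] at hi ⊢
    omega
  all_goals simp

end SIdx

namespace SympParam

theorem qm_neg_self (q : SympParam K r) (i : SIdx r) : q.qm (-i) i = q.qv i ^ 2 := by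
  rw [q.qm_neg, q.qm_diag]; simp

theorem qm_mul_qm_neg (q : SympParam K r) (i j : SIdx r) :
    q.qm i j * q.qm (-i) j = q.qv j ^ 2 := by
  rw [q.qm_neg, mul_inv_cancel_left₀ (q.qm_ne i j)]

end SympParam

section Monomials

variable {A : Type*} [Ring A] [Algebra K A] {q : SympParam K r} {x : SIdx r → A}

theorem exists_prod_eq_smul_of_perm (hx : ∀ l m, x l * x m = -(q.qm l m • (x m * x l)))
    {L L' : List (SIdx r)} (h : L.Perm L') :
    ∃ c : K, (L.map x).prod = c • (L'.map x).prod := by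
  induction h with
  | nil => exact ⟨1, by simp⟩
  | cons a _ ih =>
    obtain ⟨c, hc⟩ := ih
    exact ⟨c, by simp [hc]⟩
  | swap a b L =>
    refine ⟨-q.qm b a, ?_⟩
    simp only [List.map_cons, List.prod_cons, ← mul_assoc]
    rw [hx b a]
    simp
  | trans _ _ ih₁ ih₂ =>
    obtain ⟨c, hc⟩ := ih₁
    obtain ⟨d, hd⟩ := ih₂
    exact ⟨c * d, by rw [hc, hd, mul_smul]⟩

theorem mul_self_eq_zero_of_skew (hx : ∀ l m, x l * x m = -(q.qm l m • (x m * x l)))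
    (i : SIdx r) : x i * x i = 0 := by
  have h := hx i i
  rw [q.qm_diag, one_smul, eq_neg_iff_add_eq_zero, ← two_smul K] at h
  exact (smul_eq_zero_iff_right two_ne_zero).mp h

theorem prod_eq_zero_of_not_nodup (hx : ∀ l m, x l * x m = -(q.qm l m • (x m * x l)))
    {L : List (SIdx r)} (h : ¬ L.Nodup) : (L.map x).prod = 0 := by
  obtain ⟨a, ha⟩ := (List.exists_duplicate_iff_not_nodup).mpr h
  obtain ⟨L', hL'⟩ := (List.duplicate_iff_sublist.mp ha).exists_perm_append
  obtain ⟨c, hc⟩ := exists_prod_eq_smul_of_perm hx hL'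
  rw [hc]
  simp [← mul_assoc, mul_self_eq_zero_of_skew hx]

theorem pair_mul (hx : ∀ l m, x l * x m = -(q.qm l m • (x m * x l))) (i j : SIdx r) :
    x i * x (-i) * x j = q.qv j ^ 2 • (x j * (x i * x (-i))) := by
  rw [mul_assoc, hx (-i) j, mul_neg, mul_smul_comm, ← mul_assoc, hx i j, ← q.qm_mul_qm_neg i j]
  simp only [neg_mul, smul_mul_assoc, smul_neg, _root_.neg_neg, smul_smul, mul_assoc]
  rw [mul_comm]

theorem pair_commute (hx : ∀ l m, x l * x m = -(q.qm l m • (x m * x l))) (i j : SIdx r) :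
    (x i * x (-i)) * (x j * x (-j)) = (x j * x (-j)) * (x i * x (-i)) := by
  rw [← mul_assoc, pair_mul hx, smul_mul_assoc, mul_assoc (x j), pair_mul hx, q.qv_neg,
    mul_smul_comm, smul_smul, mul_assoc (x j)]
  have := q.qv_ne j
  rw [inv_pow, mul_inv_cancel₀ (pow_ne_zero 2 this), one_smul]

theorem sum_pos_pair_eq_zero (hx : ∀ l m, x l * x m = -(q.qm l m • (x m * x l)))
    (hω : ∑ i, (sgn K i * q.qv i) • (x i * x (-i)) = 0) :
    ∑ i ∈ SIdx.pos r, q.qv i • (x i * x (-i)) = 0 := by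
  have h : ∀ i ∈ SIdx.pos r, (sgn K i * q.qv i) • (x i * x (-i)) +
      (sgn K (-i) * q.qv (-i)) • (x (-i) * x (- -i)) = (2 : K) • q.qv i • (x i * x (-i)) := by
    intro i hi
    rw [SIdx.mem_pos] at hi
    have h1 : sgn K i = 1 := if_pos hi
    have h2 : sgn K (-i) = -1 := if_neg (by simp; omega)
    have h3 := q.qv_ne i
    rw [SIdx.neg_neg, hx (-i) i, h1, h2, q.qv_neg, q.qm_neg_self, two_smul, one_mul]
    congr 1
    rw [smul_neg, smul_smul, ← neg_smul]
    congr 1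
    field_simp
  rw [SIdx.sum_eq_sum_pos, Finset.sum_congr rfl h, ← Finset.smul_sum] at hω
  exact (smul_eq_zero_iff_right two_ne_zero).mp hω

theorem prod_flatMap_pair (L : List (SIdx r)) :
    ((L.flatMap fun i => [i, -i]).map x).prod = (L.map fun i => x i * x (-i)).prod := by
  induction L with
  | nil => simp
  | cons a L ih => simp [ih, mul_assoc]

/-- The hard Lefschetz type vanishing: a product over `S` of commuting square-zero elements `v i`
kills `t` when a linear relation over `S ∪ U ∪ R` holds, `U` is smaller than `S`, and the
`v i` with `i ∈ R` kill `t`. -/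
theorem prod_mul_eq_zero_of_sum_eq_zero {ι : Type*} {v : ι → A} {c : ι → K}
    (hc : ∀ i, c i ≠ 0) (hcomm : ∀ i j, v i * v j = v j * v i) (hsq : ∀ i, v i * v i = 0)
    {S U R : Finset ι} (hsum : ∑ i ∈ S, c i • v i + ∑ i ∈ U, c i • v i +
      ∑ i ∈ R, c i • v i = 0) {t : A} (ht : ∀ i ∈ R, v i * t = 0) (hcard : U.card < S.card) :
    (S.toList.map v).prod * t = 0 := by
  let s := Set.range v
  have hs : ∀ a ∈ s, ∀ b ∈ s, a * b = b * a := by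
    rintro _ ⟨i, rfl⟩ _ ⟨j, rfl⟩
    exact hcomm i j
  let _ : CommRing (Algebra.adjoin K s) :=
    { (Algebra.adjoin K s).toRing with
      mul_comm := (Algebra.isMulCommutative_adjoin K hs).is_comm.comm }
  let w : ι → Algebra.adjoin K s := fun i => ⟨v i, Algebra.subset_adjoin ⟨i, rfl⟩⟩
  let z : ι → Algebra.adjoin K s := fun i => c i • w i
  have hz : ∀ i, z i * z i = 0 := fun i => by
    apply Subtype.ext
    change c i • v i * c i • v i = 0
    rw [smul_mul_smul_comm, hsq, smul_zero]
  have hzs : ∀ T : Finset ι, ((∑ i ∈ T, z i : Algebra.adjoin K s) : A) = ∑ i ∈ T, c i • v i :=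
    fun T => map_sum (Algebra.adjoin K s).val z T
  have hprod : ((∏ i ∈ S, z i : Algebra.adjoin K s) : A)
      = (∏ i ∈ S, c i) • (S.toList.map v).prod := by
    rw [← Finset.prod_map_toList S z, ← Finset.prod_map_toList S c]
    induction S.toList with
    | nil => simp
    | cons a L ih =>
      simp only [List.map_cons, List.prod_cons]
      rw [← smul_mul_smul_comm, ← ih]
      rfl
  have hpow := sum_pow_card_of_mul_self_eq_zero hz S
  obtain ⟨d, hd⟩ := sub_dvd_pow_sub_pow (∑ i ∈ S, z i) (-∑ i ∈ U, z i) S.card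
  rw [neg_pow, sum_pow_eq_zero_of_mul_self_eq_zero hz U hcard, mul_zero, sub_zero, sub_neg_eq_add,
    hpow, mul_comm] at hd
  have hR : ((∑ i ∈ S, z i + ∑ i ∈ U, z i : Algebra.adjoin K s) : A) * t = 0 := by
    have h : ((∑ i ∈ S, z i + ∑ i ∈ U, z i : Algebra.adjoin K s) : A)
        = -∑ i ∈ R, c i • v i := by
      rw [← eq_neg_iff_add_eq_zero, ← hzs, ← hzs] at hsum
      exact hsum
    rw [h, neg_mul, Finset.sum_mul, Finset.sum_eq_zero, neg_zero]
    intro i hi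
    rw [smul_mul_assoc, ht i hi, smul_zero]
  have key : ((∏ i ∈ S, z i : Algebra.adjoin K s) : A) * (S.card.factorial : A) * t = 0 := by
    have h := congrArg (fun y : Algebra.adjoin K s => (y : A) * t) (hd.trans (mul_comm _ _))
    change _ = (d : A) * ((∑ i ∈ S, z i + ∑ i ∈ U, z i : Algebra.adjoin K s) : A) * t at h
    rw [mul_assoc, hR, mul_zero] at h
    exact h
  rw [hprod, mul_assoc, ← nsmul_eq_mul, ← Nat.cast_smul_eq_nsmul K, mul_smul_comm,
    smul_mul_assoc, smul_smul] at key
  refine (smul_eq_zero_iff_right (mul_ne_zero ?_ ?_)).mp key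
  · exact_mod_cast Nat.factorial_ne_zero _
  · exact Finset.prod_ne_zero_iff.mpr fun i _ => hc i

theorem prod_eq_zero_of_lt_length (hx : ∀ l m, x l * x m = -(q.qm l m • (x m * x l)))
    (hω : ∑ i, (sgn K i * q.qv i) • (x i * x (-i)) = 0) {L : List (SIdx r)}
    (hL : r < L.length) : (L.map x).prod = 0 := by
  by_cases hnd : L.Nodup
  swap
  · exact prod_eq_zero_of_not_nodup hx hnd
  let S := (SIdx.pos r).filter fun i => i ∈ L ∧ -i ∈ L
  let U := (SIdx.pos r).filter fun i => i ∉ L ∧ -i ∉ L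
  let R := (SIdx.pos r).filter fun i => ¬ (i ∈ L ↔ -i ∈ L)
  let L₁ := S.toList.flatMap fun i => [i, -i]
  let T := L.filter fun i => ! decide (i ∈ L₁)
  have hmem₁ : ∀ i, i ∈ L₁ ↔ i ∈ L ∧ -i ∈ L := by
    intro i
    simp only [L₁, List.mem_flatMap, Finset.mem_toList, S, Finset.mem_filter, SIdx.mem_pos,
      List.mem_cons, List.not_mem_nil, or_false]
    constructor
    · rintro ⟨j, ⟨-, h1, h2⟩, rfl | rfl⟩
      · exact ⟨h1, h2⟩
      · exact ⟨h2, by simpa using h1⟩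
    · rintro ⟨h1, h2⟩
      rcases lt_or_gt_of_ne (SIdx.coe_ne_zero i) with h | h
      · exact ⟨-i, ⟨by simpa using h, h2, by simpa using h1⟩, Or.inr (by simp)⟩
      · exact ⟨i, ⟨h, h1, h2⟩, Or.inl rfl⟩
  have hnd₁ : L₁.Nodup := by
    refine List.nodup_flatMap.mpr ⟨fun i _ => ?_, ?_⟩
    · have := SIdx.coe_ne_zero i
      simp only [List.nodup_cons, List.mem_singleton, List.not_mem_nil, not_false_eq_true,
        List.nodup_nil, and_true, Subtype.ext_iff, SIdx.coe_neg]
      omega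
    · refine (Finset.nodup_toList S).pairwise_of_forall_ne ?_
      intro i hi j hj hij
      have hi' := SIdx.mem_pos.mp (Finset.mem_filter.mp (Finset.mem_toList.mp hi)).1
      have hj' := SIdx.mem_pos.mp (Finset.mem_filter.mp (Finset.mem_toList.mp hj)).1
      have : (i : ℤ) ≠ j := fun h => hij (Subtype.ext h)
      simp only [Function.onFun, List.Disjoint, List.mem_cons, List.not_mem_nil, or_false,
        Subtype.ext_iff, SIdx.coe_neg]
      omega
  have hperm : L.Perm (L₁ ++ T) := by
    refine (List.filter_append_perm (fun i => decide (i ∈ L₁)) L).symm.trans ?_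
    refine List.Perm.append_right _ ?_
    refine (List.perm_ext_iff_of_nodup (hnd.filter _) hnd₁).mpr fun i => ?_
    simp only [List.mem_filter, decide_eq_true_eq, hmem₁]
    tauto
  have hcard : U.card < S.card := by
    have h : L.length + U.card = (SIdx.pos r).card + S.card := by
      have h1 : L.length = ∑ i ∈ SIdx.pos r,
          ((if i ∈ L then 1 else 0) + (if -i ∈ L then 1 else 0)) := by
        rw [← SIdx.sum_eq_sum_pos (fun i => if i ∈ L then 1 else 0), ← List.toFinset_card_of_nodup
          hnd, Finset.card_eq_sum_ones, ← Finset.sum_filter]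
        congr 1
        ext i
        simp
      rw [h1, Finset.card_filter, Finset.card_filter, Finset.card_eq_sum_ones (SIdx.pos r), ← Finset.sum_add_distrib,
        ← Finset.sum_add_distrib]
      refine Finset.sum_congr rfl fun i _ => ?_
      by_cases h3 : i ∈ L <;> by_cases h4 : -i ∈ L <;> simp [h3, h4]
    rw [SIdx.card_pos] at h
    omega
  have hsum : ∑ i ∈ S, q.qv i • (x i * x (-i)) + ∑ i ∈ U, q.qv i • (x i * x (-i)) +
      ∑ i ∈ R, q.qv i • (x i * x (-i)) = 0 := by
    rw [← sum_pos_pair_eq_zero hx hω, Finset.sum_filter, Finset.sum_filter, Finset.sum_filter,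
      ← Finset.sum_add_distrib, ← Finset.sum_add_distrib]
    refine Finset.sum_congr rfl fun i _ => ?_
    by_cases h3 : i ∈ L <;> by_cases h4 : -i ∈ L <;> simp [h3, h4]
  have hT : ∀ i, i ∈ T ↔ i ∈ L ∧ -i ∉ L := by
    intro i
    simp only [T, List.mem_filter, Bool.not_eq_true', decide_eq_false_iff_not, hmem₁]
    tauto
  have hRT : ∀ i ∈ R, x i * x (-i) * (T.map x).prod = 0 := by
    intro i hi
    have hi' := (Finset.mem_filter.mp hi).2
    have h : ¬ (i :: -i :: T).Nodup := by
      have h1 := hT i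
      have h2 := hT (-i)
      rw [SIdx.neg_neg] at h2
      simp only [List.nodup_cons, List.mem_cons]
      tauto
    simpa [mul_assoc] using prod_eq_zero_of_not_nodup hx h
  obtain ⟨c, hc⟩ := exists_prod_eq_smul_of_perm hx hperm
  rw [hc, List.map_append, List.prod_append, prod_flatMap_pair,
    prod_mul_eq_zero_of_sum_eq_zero (v := fun i => x i * x (-i)) q.qv_ne (pair_commute hx) ?_
      hsum hRT hcard, smul_zero]
  intro i
  have h : ¬ [i, -i, i, -i].Nodup := by simp
  simpa [mul_assoc] using prod_eq_zero_of_not_nodup hx h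

end Monomials

section Congruence

variable {F M : Type*} [Ring F] [Algebra K F] [AddCommGroup M] [Module K M]

/-- The congruence on an algebra `F` whose zero class is the largest two-sided ideal contained
in the kernel of a linear map. -/
def kerCon (Φ : F →ₗ[K] M) : RingCon F where
  r y z := ∀ a b, Φ (a * y * b) = Φ (a * z * b)
  iseqv := ⟨fun _ _ _ => rfl, fun h a b => (h a b).symm, fun h h' a b => (h a b).trans (h' a b)⟩
  add' h h' a b := by simp only [mul_add, add_mul, map_add, h a b, h' a b]
  mul' {y z y' z'} h h' a b := by
    have h1 := h a (y' * b)
    have h2 := h' (a * z) b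
    simp only [← mul_assoc] at h1 h2 ⊢
    rw [h1, h2]

theorem coe_kerCon_eq_zero {Φ : F →ₗ[K] M} {y : F} :
    (y : (kerCon Φ).Quotient) = 0 ↔ ∀ a b, Φ (a * y * b) = 0 := by
  rw [← RingCon.coe_zero, RingCon.eq]
  simp [kerCon]

end Congruence

section Words

variable {M : Type*} [AddCommGroup M] [Module K M]

/-- The monomial of the free algebra attached to a word. -/
def wordMonomial (K : Type*) [Field K] {r : ℕ} (L : List (SIdx r)) :
    MonoidAlgebra K (FreeMonoid (SIdx r)) :=
  MonoidAlgebra.single (FreeMonoid.ofList L) 1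

theorem wordMonomial_mul (L L' : List (SIdx r)) :
    wordMonomial K L * wordMonomial K L' = wordMonomial K (L ++ L') := by
  simp [wordMonomial, MonoidAlgebra.single_mul_single]

/-- The linear map on the free algebra with prescribed values on words. -/
def wordLift (g : List (SIdx r) → M) : MonoidAlgebra K (FreeMonoid (SIdx r)) →ₗ[K] M :=
  Finsupp.linearCombination K (fun m : FreeMonoid (SIdx r) => g m.toList) ∘ₗ
    (MonoidAlgebra.coeffLinearEquiv K).toLinearMap

@[simp] theorem wordLift_wordMonomial (g : List (SIdx r) → M) (L : List (SIdx r)) :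
    wordLift (K := K) g (wordMonomial K L) = g L := by
  simp [wordLift, wordMonomial]

theorem coe_kerCon_wordLift_eq_zero {g : List (SIdx r) → M}
    {y : MonoidAlgebra K (FreeMonoid (SIdx r))}
    (h : ∀ u v, wordLift g (wordMonomial K u * y * wordMonomial K v) = 0) :
    (y : (kerCon (wordLift (K := K) g)).Quotient) = 0 := by
  refine coe_kerCon_eq_zero.mpr fun a b => ?_
  induction a using MonoidAlgebra.induction_linear with
  | zero => simp
  | add a a' ha ha' => simp only [add_mul, map_add, ha, ha', add_zero]
  | single m c =>
    induction b using MonoidAlgebra.induction_linear with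
    | zero => simp
    | add b b' hb hb' => simp only [mul_add, map_add, hb, hb', add_zero]
    | single n d =>
      have h1 : ∀ (m : FreeMonoid (SIdx r)) (c : K),
          MonoidAlgebra.single m c = c • wordMonomial K m.toList := by
        simp [wordMonomial]
      rw [h1 m, h1 n, smul_mul_assoc, smul_mul_assoc, mul_smul_comm, map_smul, map_smul, h,
        smul_zero, smul_zero]

/-- A function on words compatible with the defining relations of the quadratic algebra
vanishes on all words of length greater than `r`. -/
theorem word_function_eq_zero (q : SympParam K r) (g : List (SIdx r) → M)
    (hskew : ∀ u v l m, g (u ++ l :: m :: v) + q.qm l m • g (u ++ m :: l :: v) = 0)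
    (hω : ∀ u v, ∑ i, (sgn K i * q.qv i) • g (u ++ i :: -i :: v) = 0)
    {L : List (SIdx r)} (hL : r < L.length) : g L = 0 := by
  let x : SIdx r → (kerCon (wordLift (K := K) g)).Quotient := fun i => (wordMonomial K [i] : _)
  have hprod : ∀ L : List (SIdx r), (L.map x).prod = (wordMonomial K L : _) := by
    intro L
    induction L with
    | nil => rfl
    | cons a L ih =>
      rw [List.map_cons, List.prod_cons, ih, ← RingCon.coe_mul, wordMonomial_mul]
      rfl
  have hpair : ∀ l m, x l * x m = (wordMonomial K [l, m] : _) := fun l m => by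
    simpa using hprod [l, m]
  have h1 : ∀ l m, x l * x m = -(q.qm l m • (x m * x l)) := by
    intro l m
    rw [eq_neg_iff_add_eq_zero, hpair, hpair, ← RingCon.coe_smul, ← RingCon.coe_add]
    refine coe_kerCon_wordLift_eq_zero fun u v => ?_
    simpa [mul_add, add_mul, wordMonomial_mul] using hskew u v l m
  have h2 : ∑ i, (sgn K i * q.qv i) • (x i * x (-i)) = 0 := by
    have h3 : ∑ i, (sgn K i * q.qv i) • (x i * x (-i)) =
        ((∑ i, (sgn K i * q.qv i) • wordMonomial K [i, -i] :
          MonoidAlgebra K (FreeMonoid (SIdx r))) : (kerCon (wordLift (K := K) g)).Quotient) := by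
      rw [← RingCon.coe_mk', map_sum]
      simp [hpair]
    rw [h3]
    refine coe_kerCon_wordLift_eq_zero fun u v => ?_
    simpa [Finset.mul_sum, Finset.sum_mul, wordMonomial_mul] using hω u v
  have h := prod_eq_zero_of_lt_length h1 h2 hL
  rw [hprod, coe_kerCon_eq_zero] at h
  simpa using h 1 1

end Words

section Operators

variable {k : ℕ}

/-- The `q`-deformed symplectic tensor `∑ i, ε_i q_i • (e i ⊗ e (-i))`. -/
def symplecticTensor (q : SympParam K r) : SIdx r × SIdx r → K := fun p =>
  if p.2 = -p.1 then sgn K p.1 * q.qv p.1 else 0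

theorem sgn_mul_self (i : SIdx r) : sgn K i * sgn K i = 1 := by
  unfold sgn; split_ifs <;> simp

theorem sgn_neg (i : SIdx r) : sgn K (-i) = -sgn K i := by
  have := SIdx.coe_ne_zero i
  unfold sgn
  simp only [SIdx.coe_neg]
  split_ifs <;> first | omega | simp

theorem card_SIdx : Fintype.card (SIdx r) = 2 * r := by
  rw [← Finset.card_univ, Finset.card_eq_sum_ones, SIdx.sum_eq_sum_pos]
  simp [SIdx.card_pos, mul_comm]

theorem Qq_eq_smul (q : SympParam K r) (f : SIdx r × SIdx r → K) :
    Qq q f = (∑ l, sgn K l * (q.qv l)⁻¹ * f (l, -l)) • symplecticTensor q := by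
  funext p
  simp only [Qq, symplecticTensor, LinearMap.coe_mk, AddHom.coe_mk, Pi.smul_apply, smul_eq_mul]
  split_ifs <;> ring

theorem Qq_symplecticTensor (q : SympParam K r) :
    Qq q (symplecticTensor q) = (2 * r : K) • symplecticTensor q := by
  rw [Qq_eq_smul]
  congr 1
  have h : ∀ l : SIdx r, sgn K l * (q.qv l)⁻¹ * symplecticTensor q (l, -l) = 1 := by
    intro l
    have h1 := q.qv_ne l
    simp only [symplecticTensor, if_true]
    rw [mul_mul_mul_comm, sgn_mul_self, inv_mul_cancel₀ h1, one_mul]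
  rw [Finset.sum_congr rfl fun l _ => h l, Finset.sum_const, Finset.card_univ, card_SIdx]
  simp

theorem Pq_symplecticTensor (q : SympParam K r) :
    Pq q (symplecticTensor q) = -symplecticTensor q := by
  funext ⟨i, j⟩
  by_cases h : j = -i
  · subst h
    have h1 := q.qv_ne i
    simp only [Pq, symplecticTensor, LinearMap.coe_mk, AddHom.coe_mk, Pi.neg_apply,
      SIdx.neg_neg, if_true, sgn_neg, q.qv_neg, q.qm_neg_self]
    field_simp
  · have h' : i ≠ -j := fun h' => h (by rw [h', SIdx.neg_neg])
    simp [Pq, symplecticTensor, h, h']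

theorem Pq_single (q : SympParam K r) (l m : SIdx r) :
    Pq q (Pi.single (l, m) 1) = q.qm l m • Pi.single (m, l) 1 := by
  funext ⟨i, j⟩
  by_cases h : (i, j) = (m, l)
  · obtain ⟨rfl, rfl⟩ := Prod.mk.inj h
    simp [Pq]
  · have h' : (j, i) ≠ (l, m) := by
      simp only [ne_eq, Prod.mk.injEq] at h ⊢
      tauto
    simp [Pq, Pi.single_eq_of_ne h, Pi.single_eq_of_ne h']

/-- The embedding of `V ⊗ V` into `V^{⊗k}` at the factors `a`, `b`, the other factors being the
basis vectors prescribed by `u`. -/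
def insertAB (u : Fin k → SIdx r) (a b : Fin k) :
    (SIdx r × SIdx r → K) →ₗ[K] ((Fin k → SIdx r) → K) where
  toFun f v := if ∀ c, c ≠ a → c ≠ b → v c = u c then f (v a, v b) else 0
  map_add' f g := by funext v; dsimp only [Pi.add_apply, Pi.smul_apply]; split_ifs <;> simp
  map_smul' c f := by funext v; dsimp only [Pi.add_apply, Pi.smul_apply]; split_ifs <;> simp

theorem liftAB_insertAB (T : Module.End K (SIdx r × SIdx r → K)) (u : Fin k → SIdx r)
    {a b : Fin k} (hab : a ≠ b) (f : SIdx r × SIdx r → K) :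
    liftAB T a b (insertAB u a b f) = insertAB u a b (T f) := by
  funext v
  have h : ∀ l m, insertAB u a b f (Function.update (Function.update v a l) b m) =
      if ∀ c, c ≠ a → c ≠ b → v c = u c then f (l, m) else 0 := by
    intro l m
    simp only [insertAB, LinearMap.coe_mk, AddHom.coe_mk, Function.update_self,
      Function.update_of_ne hab]
    refine if_congr (forall_congr' fun c => forall₂_congr fun h1 h2 => ?_) rfl rfl
    rw [Function.update_of_ne h2, Function.update_of_ne h1]
  simp only [liftAB, LinearMap.coe_mk, AddHom.coe_mk, h]
  by_cases hv : ∀ c, c ≠ a → c ≠ b → v c = u c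
  · simp only [insertAB, LinearMap.coe_mk, AddHom.coe_mk, if_pos hv]
    rw [LinearMap.pi_apply_eq_sum_univ T f, Finset.sum_apply, Fintype.sum_prod_type]
    refine Finset.sum_congr rfl fun l _ => Finset.sum_congr rfl fun m _ => ?_
    rw [Pi.smul_apply, smul_eq_mul, mul_comm]
    have hs : (Pi.single (l, m) 1 : SIdx r × SIdx r → K) = fun p => if (l, m) = p then 1 else 0 :=
      funext fun p => by simp [Pi.single_apply, eq_comm]
    rw [hs]
  · simp [insertAB, hv]

theorem insertAB_single (u : Fin k → SIdx r) {a b : Fin k} {p : SIdx r × SIdx r}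
    {w : Fin k → SIdx r} (ha : w a = p.1) (hb : w b = p.2)
    (hw : ∀ c, c ≠ a → c ≠ b → w c = u c) :
    insertAB u a b (Pi.single p 1) = (Pi.single w 1 : (Fin k → SIdx r) → K) := by
  funext v
  by_cases hv : v = w
  · subst hv
    simp [insertAB, if_pos hw, ha, hb]
  · rw [Pi.single_eq_of_ne hv]
    simp only [insertAB, LinearMap.coe_mk, AddHom.coe_mk]
    split_ifs with h
    · refine Pi.single_eq_of_ne ?_ _
      rintro rfl
      refine hv (funext fun c => ?_)
      by_cases h1 : c = a
      · rw [h1, ha]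
      by_cases h2 : c = b
      · rw [h2, hb]
      rw [h c h1 h2, hw c h1 h2]
    · rfl

variable {M : Type*} [AddCommGroup M] [Module K M]

theorem map_symplecticTensor_eq_zero (hr : 1 ≤ r) (q : SympParam K r)
    {h : (SIdx r × SIdx r → K) →ₗ[K] M} (hh : ∀ f, h (f - Cq q f) = 0) :
    h (symplecticTensor q) = 0 := by
  have h1 : symplecticTensor q - Cq q (symplecticTensor q) = symplecticTensor q := by
    have hr' : (r : K) ≠ 0 := Nat.cast_ne_zero.mpr (by omega)
    simp only [Cq, LinearMap.sub_apply, LinearMap.smul_apply, Module.End.one_apply,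
      Qq_symplecticTensor, Pq_symplecticTensor]
    rw [smul_smul, inv_mul_cancel₀ (mul_ne_zero two_ne_zero hr')]
    module
  rw [← h1]
  exact hh _

theorem map_single_add_eq_zero (hr : 1 ≤ r) (q : SympParam K r)
    {h : (SIdx r × SIdx r → K) →ₗ[K] M} (hh : ∀ f, h (f - Cq q f) = 0) (l m : SIdx r) :
    h (Pi.single (l, m) 1) + q.qm l m • h (Pi.single (m, l) 1) = 0 := by
  have h1 := hh (Pi.single (l, m) 1)
  simp only [Cq, LinearMap.sub_apply, LinearMap.smul_apply, Module.End.one_apply, Pq_single,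
    Qq_eq_smul, map_sub, map_smul, map_symplecticTensor_eq_zero hr q hh, smul_zero, sub_zero] at h1
  have h2 := congrArg ((2 : K) • ·) h1
  simp only [smul_zero] at h2
  rw [← h2]
  module

theorem symplecticTensor_eq_sum (q : SympParam K r) :
    symplecticTensor q = ∑ i, (sgn K i * q.qv i) • Pi.single (i, -i) (1 : K) := by
  funext ⟨i, j⟩
  rw [Finset.sum_apply, Finset.sum_eq_single i]
  · by_cases h : j = -i
    · simp [symplecticTensor, h]
    · simp [symplecticTensor, h]
  · intro l _ hl
    simp [hl.symm]
  · simp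

theorem getD_append_cons_cons (d : SIdx r) (u v : List (SIdx r)) (l m l' m' : SIdx r) {c : ℕ}
    (h1 : c ≠ u.length) (h2 : c ≠ u.length + 1) :
    (u ++ l :: m :: v).getD c d = (u ++ l' :: m' :: v).getD c d := by
  rcases lt_or_ge c u.length with h | h
  · rw [List.getD_append _ _ _ _ h, List.getD_append _ _ _ _ h]
  · obtain ⟨n, rfl⟩ : ∃ n, c = u.length + (n + 2) := ⟨c - u.length - 2, by omega⟩
    rw [List.getD_append_right _ _ _ _ h, List.getD_append_right _ _ _ _ h]
    simp

end Operators

theorem map_single_eq_zero {M : Type*} [AddCommGroup M] [Module K M] (hr : 1 ≤ r)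
    (q : SympParam K r) {k : ℕ} (hk : r + 1 ≤ k) (g : ((Fin k → SIdx r) → K) →ₗ[K] M)
    (hg : ∀ (a b : Fin k), a.1 + 1 = b.1 → ∀ f, g (f - liftAB (Cq q) a b f) = 0)
    (v : Fin k → SIdx r) : g (Pi.single v 1) = 0 := by
  let d : SIdx r := v ⟨0, by omega⟩
  let toFun : List (SIdx r) → Fin k → SIdx r := fun L c => L.getD c d
  let G : List (SIdx r) → M := fun L => if L.length = k then g (Pi.single (toFun L) 1) else 0
  have hG : ∀ u w : List (SIdx r), (∀ l m, G (u ++ l :: m :: w) = 0) ∨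
      ∃ h : (SIdx r × SIdx r → K) →ₗ[K] M, (∀ f, h (f - Cq q f) = 0) ∧
        ∀ l m, G (u ++ l :: m :: w) = h (Pi.single (l, m) 1) := by
    intro u w
    by_cases hlen : u.length + w.length + 2 = k
    · right
      let a : Fin k := ⟨u.length, by omega⟩
      let b : Fin k := ⟨u.length + 1, by omega⟩
      have hab : a ≠ b := by simp [a, b]
      refine ⟨g ∘ₗ insertAB (toFun (u ++ d :: d :: w)) a b, fun f => ?_, fun l m => ?_⟩
      · rw [LinearMap.comp_apply, map_sub, ← liftAB_insertAB _ _ hab]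
        exact hg a b rfl _
      · have hlen' : (u ++ l :: m :: w).length = k := by simp; omega
        simp only [G, if_pos hlen', LinearMap.comp_apply]
        rw [insertAB_single (w := toFun (u ++ l :: m :: w))]
        · simp [toFun, a]
        · simp [toFun, b]
        · intro c h1 h2
          exact getD_append_cons_cons _ _ _ _ _ _ _ (fun h => h1 (Fin.ext h))
            (fun h => h2 (Fin.ext h))
    · left
      intro l m
      exact if_neg (by simp; omega)
  have hzero : G (List.ofFn v) = 0 := by
    refine word_function_eq_zero q G ?_ ?_ (by simpa using hk)
    · intro u w l m
      rcases hG u w with h | ⟨h, hh, hGh⟩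
      · simp [h]
      · rw [hGh, hGh]
        exact map_single_add_eq_zero hr q hh l m
    · intro u w
      rcases hG u w with h | ⟨h, hh, hGh⟩
      · simp [h]
      · simp only [hGh]
        rw [← map_symplecticTensor_eq_zero hr q hh, symplecticTensor_eq_sum, map_sum]
        simp only [map_smul]
  have hv : toFun (List.ofFn v) = v := by
    funext c
    simp [toFun]
  simpa [G, hv] using hzero

/-- for `k ≥ r + 1`, the images of the operators `(1 − C_q)^{(a,a+1)}`
span all of `V^{⊗k}`; equivalently, the `k`-th graded component of `Ξ_{C_q}(K)` is zero. -/
theorem component_vanishes (hr : 1 ≤ r) (q : SympParam K r) (k : ℕ) (hk : r + 1 ≤ k) :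
    (⨆ a : Fin (k - 1), LinearMap.range
        ((1 : Module.End K ((Fin k → SIdx r) → K))
          - liftAB (Cq q) ⟨a.1, by have := a.2; omega⟩ ⟨a.1 + 1, by have := a.2; omega⟩))
      = ⊤ := by
  set W : Submodule K ((Fin k → SIdx r) → K) := ⨆ a : Fin (k - 1), LinearMap.range
    ((1 : Module.End K ((Fin k → SIdx r) → K))
      - liftAB (Cq q) ⟨a.1, by have := a.2; omega⟩ ⟨a.1 + 1, by have := a.2; omega⟩) with hW
  have hg : ∀ a b : Fin k, a.1 + 1 = b.1 → ∀ f, W.mkQ (f - liftAB (Cq q) a b f) = 0 := by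
    rintro ⟨a, ha⟩ ⟨b, hb⟩ hab f
    obtain rfl : a + 1 = b := hab
    rw [Submodule.mkQ_apply, Submodule.Quotient.mk_eq_zero, hW]
    exact Submodule.mem_iSup_of_mem (⟨a, by omega⟩ : Fin (k - 1)) ⟨f, rfl⟩
  have hzero : W.mkQ = 0 := LinearMap.pi_ext' fun v => LinearMap.ext_ring
    (map_single_eq_zero hr q hk W.mkQ hg v)
  rw [← Submodule.ker_mkQ W, hzero, LinearMap.ker_zero]
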